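/- Newton's identities hold for Manin matrices: if M is an n×n Manin matrix, σ_k are the coefficients of the column-determinant characteristic polynomial det^col(t + M) = Σ_{k=0}^n σ_k t^{n−k} (with σ_0 = 1, t a central variable), and τ_i = Tr(M^i), then (−1)^{k+1} k σ_k = Σ_{i=0}^{k−1} (−1)^i σ_i τ_{k−i} for 1 ≤ k ≤ n. -/

import Mathlib

/-- The column determinant of a square matrix over a noncommutative ring. -/
def detCol {R : Type*} [Ring R] {n : ℕ} (M : Matrix (Fin n) (Fin n) R) : R :=
  ∑ σ : Equiv.Perm (Fin n),
    (Equiv.Perm.sign σ : ℤ) • (List.ofFn fun t => M (σ t) t).prod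

/-- The signed sum of column-ordered products with the `k`-th factor omitted, over the
permutations sending `k` to `l`: the left adjugate of a Manin matrix. -/
def adjCol {R : Type*} [Ring R] {n : ℕ} (N : Matrix (Fin n) (Fin n) R) :
    Matrix (Fin n) (Fin n) R := fun k l =>
  ∑ σ : Equiv.Perm (Fin n), (Equiv.Perm.sign σ : ℤ) •
    if σ k = l then (List.ofFn (Function.update (fun t => N (σ t) t) k 1)).prod else 0

theorem take_ofFn_update {α : Type*} {n : ℕ} (f : Fin n → α) (p : Fin n) (a : α) :
    (List.ofFn (Function.update f p a)).take p = (List.ofFn f).take p := by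
  refine List.ext_getElem (by simp) fun i h _ => ?_
  have hi : i < p := by simp at h; omega
  simp [Fin.ext_iff, hi.ne]

theorem drop_ofFn_update {α : Type*} {n : ℕ} (f : Fin n → α) (p : Fin n) (a : α) :
    (List.ofFn (Function.update f p a)).drop (p + 1) = (List.ofFn f).drop (p + 1) := by
  refine List.ext_getElem (by simp) fun i h _ => ?_
  have hi : (p : ℕ) + 1 + i ≠ p := by omega
  simp [Fin.ext_iff, hi]

theorem prod_take_succ_ofFn {S : Type*} [Monoid S] {n : ℕ} (f : Fin n → S) (p : Fin n) :
    ((List.ofFn f).take (p + 1)).prod = ((List.ofFn f).take p).prod * f p := by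
  rw [List.prod_take_succ _ _ (by simp)]
  simp

theorem prod_drop_ofFn {S : Type*} [Monoid S] {n : ℕ} (f : Fin n → S) (p : Fin n) :
    ((List.ofFn f).drop p).prod = f p * ((List.ofFn f).drop (p + 1)).prod := by
  rw [List.drop_eq_getElem_cons (by simp), List.prod_cons]
  simp

theorem prod_ofFn_update {S : Type*} [Monoid S] {n : ℕ} (f : Fin n → S) (p : Fin n) (a : S) :
    (List.ofFn (Function.update f p a)).prod =
      ((List.ofFn f).take p).prod * a * ((List.ofFn f).drop (p + 1)).prod := by
  rw [← List.prod_take_mul_prod_drop _ (p : ℕ), take_ofFn_update, prod_drop_ofFn,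
    drop_ofFn_update, Function.update_self, mul_assoc]

/-- A signed sum over permutations vanishes if the summand is unchanged by exchanging the
values at two distinct points. -/
theorem sum_sign_smul_eq_zero {S : Type*} [Ring S] {n : ℕ} {k p : Fin n} (hkp : k ≠ p)
    (F : Equiv.Perm (Fin n) → S) (hF : ∀ σ, F (σ * Equiv.swap k p) = F σ) :
    ∑ σ : Equiv.Perm (Fin n), (Equiv.Perm.sign σ : ℤ) • F σ = 0 := by
  refine Finset.sum_involution (fun σ _ => σ * Equiv.swap k p) ?_ ?_ ?_ ?_
  · intro σ _
    simp [hF, Equiv.Perm.sign_swap hkp]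
  · intro σ _ _ h
    exact hkp (Equiv.swap_eq_one_iff.1 (mul_eq_left.1 h))
  · simp
  · intro σ _
    simp [mul_assoc]

/-- The column-ordered product along `σ` with the `k`-th factor omitted and the entry of
column `j` in row `σ k` inserted at position `p`. -/
def insertedProd {S : Type*} [Ring S] {n : ℕ} (N : Matrix (Fin n) (Fin n) S) (k j : Fin n)
    (p : ℕ) (σ : Equiv.Perm (Fin n)) : S :=
  ((List.ofFn (Function.update (fun t => N (σ t) t) k 1)).take p).prod * N (σ k) j *
    ((List.ofFn (Function.update (fun t => N (σ t) t) k 1)).drop p).prod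

theorem update_mul_swap {S : Type*} [Ring S] {n : ℕ} (N : Matrix (Fin n) (Fin n) S)
    {k p : Fin n} (σ : Equiv.Perm (Fin n)) :
    Function.update (fun t => N ((σ * Equiv.swap k p) t) t) k 1 =
      Function.update (Function.update (Function.update (fun t => N (σ t) t) k 1) p (N (σ k) p))
        k 1 := by
  ext t
  by_cases h : t = k
  · simp [h]
  · by_cases htp : t = p
    · subst htp
      simp [h]
    · simp [h, htp, Equiv.swap_apply_of_ne_of_ne]

theorem update_mul_swap_of_ne {S : Type*} [Ring S] {n : ℕ} (N : Matrix (Fin n) (Fin n) S)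
    {k p : Fin n} (hkp : k ≠ p) (σ : Equiv.Perm (Fin n)) :
    Function.update (fun t => N ((σ * Equiv.swap k p) t) t) k 1 =
      Function.update (Function.update (fun t => N (σ t) t) k 1) p (N (σ k) p) := by
  rw [update_mul_swap, Function.update_comm hkp.symm]
  simp

theorem sum_insertedProd_succ {S : Type*} [Ring S] {n : ℕ} (N : Matrix (Fin n) (Fin n) S)
    (hcross : ∀ i j k l, N i j * N k l - N k l * N i j = N k j * N i l - N i l * N k j)
    (k j p : Fin n) :
    ∑ σ : Equiv.Perm (Fin n), (Equiv.Perm.sign σ : ℤ) • insertedProd N k j (p + 1) σ =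
      ∑ σ : Equiv.Perm (Fin n), (Equiv.Perm.sign σ : ℤ) • insertedProd N k j p σ := by
  by_cases hkp : k = p
  · subst hkp
    simp only [insertedProd, prod_take_succ_ofFn, prod_drop_ofFn, Function.update_self, mul_one,
      one_mul]
  rw [← sub_eq_zero, ← Finset.sum_sub_distrib]
  simp only [← smul_sub]
  refine sum_sign_smul_eq_zero hkp _ fun σ => ?_
  have key (a b x y z w : S) (h : x * y - y * x = z * w - w * z) :
      a * w * z * b - a * (z * (w * b)) = a * y * x * b - a * (x * (y * b)) := by
    have : a * (x * y - y * x) * b = a * (z * w - w * z) * b := by rw [h]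
    simp only [mul_sub, sub_mul, mul_assoc] at this ⊢
    rw [← neg_sub, ← this, neg_sub]
  simp only [insertedProd, update_mul_swap_of_ne N hkp]
  simp only [prod_take_succ_ofFn, prod_drop_ofFn,
    take_ofFn_update, drop_ofFn_update, Function.update_self,
    Function.update_of_ne (Ne.symm hkp), Equiv.Perm.mul_apply, Equiv.swap_apply_left, mul_assoc]
  simpa only [mul_assoc] using key _ _ _ _ _ _ (hcross (σ k) j (σ p) p)

theorem sum_insertedProd_eq {S : Type*} [Ring S] {n : ℕ} (N : Matrix (Fin n) (Fin n) S)
    (hcross : ∀ i j k l, N i j * N k l - N k l * N i j = N k j * N i l - N i l * N k j)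
    (k j : Fin n) (p : ℕ) (hp : p ≤ n) :
    ∑ σ : Equiv.Perm (Fin n), (Equiv.Perm.sign σ : ℤ) • insertedProd N k j p σ =
      ∑ σ : Equiv.Perm (Fin n), (Equiv.Perm.sign σ : ℤ) • insertedProd N k j 0 σ := by
  induction p with
  | zero => rfl
  | succ p ih => exact (sum_insertedProd_succ N hcross k j ⟨p, hp⟩).trans (ih (by omega))

theorem adjCol_mul {S : Type*} [Ring S] {n : ℕ} (N : Matrix (Fin n) (Fin n) S)
    (hcol : ∀ i k j, Commute (N i j) (N k j))
    (hcross : ∀ i j k l, N i j * N k l - N k l * N i j = N k j * N i l - N i l * N k j) :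
    adjCol N * N = Matrix.diagonal fun _ => detCol N := by
  ext k j
  have h : (adjCol N * N) k j =
      ∑ σ : Equiv.Perm (Fin n), (Equiv.Perm.sign σ : ℤ) • insertedProd N k j n σ := by
    simp only [Matrix.mul_apply, adjCol, Finset.sum_mul, smul_mul_assoc, ite_mul, zero_mul]
    rw [Finset.sum_comm]
    refine Finset.sum_congr rfl fun σ _ => ?_
    rw [← Finset.smul_sum, Finset.sum_ite_eq, if_pos (Finset.mem_univ _), insertedProd,
      List.take_of_length_le (by simp), List.drop_of_length_le (by simp)]
    simp
  rw [h, sum_insertedProd_eq N hcross k j n le_rfl]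
  by_cases hkj : k = j
  · subst hkj
    rw [← sum_insertedProd_eq N hcross k k k k.2.le, Matrix.diagonal_apply_eq, detCol]
    refine Finset.sum_congr rfl fun σ _ => ?_
    rw [insertedProd, prod_drop_ofFn, take_ofFn_update, drop_ofFn_update, Function.update_self,
      one_mul, ← prod_ofFn_update, Function.update_eq_self k (fun t => N (σ t) t)]
  · rw [← sum_insertedProd_eq N hcross k j (j + 1) j.2, Matrix.diagonal_apply_ne _ hkj]
    refine sum_sign_smul_eq_zero hkj _ fun σ => ?_
    simp only [insertedProd, update_mul_swap_of_ne N hkj]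
    simp only [prod_take_succ_ofFn,
      take_ofFn_update, drop_ofFn_update, Function.update_self,
      Function.update_of_ne (Ne.symm hkj), Equiv.Perm.mul_apply, Equiv.swap_apply_left]
    rw [mul_assoc _ (N _ _) (N _ _), (hcol _ _ _).eq, ← mul_assoc]

section Polynomial

open Polynomial

theorem derivative_prod_ofFn {R : Type*} [Ring R] {n : ℕ} (f : Fin n → R[X]) :
    derivative (List.ofFn f).prod =
      ∑ k, (List.ofFn (Function.update f k (derivative (f k)))).prod := by
  induction n with
  | zero => simp
  | succ n ih =>
    have h (k : Fin n) (a : R[X]) : (fun i : Fin n => Function.update f k.succ a i.succ) =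
        Function.update (fun i => f i.succ) k a := by
      ext1 i
      simp [Function.update_apply]
    simp [List.ofFn_succ, Fin.sum_univ_succ, ih, h, Finset.mul_sum,
      Function.update_of_ne (Fin.succ_ne_zero _).symm]

/-- The matrix `t + M` over `R[t]`. -/
noncomputable def addX {R : Type*} [Ring R] {n : ℕ} (M : Matrix (Fin n) (Fin n) R) :
    Matrix (Fin n) (Fin n) R[X] := fun i j => C (M i j) + if i = j then X else 0

theorem trace_adjCol_addX {R : Type*} [Ring R] {n : ℕ} (M : Matrix (Fin n) (Fin n) R) :
    (adjCol (addX M)).trace = derivative (detCol (addX M)) := by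
  simp only [Matrix.trace, Matrix.diag, adjCol, detCol, derivative_sum, derivative_smul,
    derivative_prod_ofFn, Finset.smul_sum]
  rw [Finset.sum_comm]
  refine Finset.sum_congr rfl fun σ _ => Finset.sum_congr rfl fun k _ => ?_
  congr 1
  split_ifs with h
  · simp [addX, h]
  · rw [prod_ofFn_update]
    simp [addX, h]

theorem coeff_adjCol_addX {R : Type*} [Ring R] {n : ℕ} (M : Matrix (Fin n) (Fin n) R)
    (k l : Fin n) : (adjCol (addX M) k l).coeff n = 0 := by
  simp only [adjCol, finsetSum_coeff, coeff_smul]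
  refine Finset.sum_eq_zero fun σ _ => ?_
  split_ifs
  · rw [coeff_eq_zero_of_natDegree_lt, smul_zero]
    refine (natDegree_list_prod_le _).trans_lt ?_
    rw [List.map_ofFn, List.sum_ofFn]
    refine (Finset.sum_lt_sum (g := fun _ => 1) (fun i _ => ?_)
      ⟨k, Finset.mem_univ _, by simp⟩).trans_le (by simp)
    rw [Function.comp_apply, Function.update_apply]
    split_ifs
    · simp
    · unfold addX
      split_ifs
      · compute_degree
      · simp
  · simp

theorem commute_addX {R : Type*} [Ring R] {n : ℕ} (M : Matrix (Fin n) (Fin n) R)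
    (hcol : ∀ i k j, Commute (M i j) (M k j)) (i k j : Fin n) :
    Commute (addX M i j) (addX M k j) := by
  have h : Commute (C (M i j)) (C (M k j)) := (hcol i k j).map C
  unfold addX
  split_ifs <;> simp [h, Commute.add_left, Commute.add_right, commute_X, (commute_X _).symm]

theorem commutator_addX {R : Type*} [Ring R] {n : ℕ} (M : Matrix (Fin n) (Fin n) R)
    (i j k l : Fin n) :
    addX M i j * addX M k l - addX M k l * addX M i j =
      C (M i j * M k l - M k l * M i j) := by
  have h (a b : R) (x y : R[X]) (hx : ∀ p, Commute x p) (hy : ∀ p, Commute y p) :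
      (C a + x) * (C b + y) - (C b + y) * (C a + x) = C (a * b - b * a) := by
    simp only [add_mul, mul_add, C_sub, C_mul, (hx _).eq, (hy (C a)).eq]
    abel
  have hX (i j : Fin n) (p : R[X]) : Commute (if i = j then X else 0) p := by
    split_ifs
    · exact commute_X p
    · exact Commute.zero_left p
  exact h _ _ _ _ (hX i j) (hX k l)

theorem coeff_mul_addX {R : Type*} [Ring R] {n : ℕ} (M : Matrix (Fin n) (Fin n) R)
    (A : Matrix (Fin n) (Fin n) R[X]) :
    (A * addX M).map (coeff · 0) = A.map (coeff · 0) * M ∧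
    ∀ m, (A * addX M).map (coeff · (m + 1)) =
      A.map (coeff · (m + 1)) * M + A.map (coeff · m) := by
  constructor
  · ext k j
    simp [Matrix.mul_apply, addX, mul_add, Finset.sum_add_distrib]
  · intro m
    ext k j
    simp [Matrix.mul_apply, addX, mul_add, Finset.sum_add_distrib]

end Polynomial

/-- Newton's identities for Manin matrices.  For an `n × n` Manin matrix `M`, let
`σ_k` be the coefficients of the column-determinant characteristic polynomial
`det^col (t·Id + M) = ∑_{k=0}^n σ_k t^{n-k}` (with `t` a central variable, working in
`R[t]`), and let `τ_i = Tr (M^i)`.  Then for `1 ≤ k ≤ n`: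
`(-1)^{k+1} k σ_k = ∑_{i=0}^{k-1} (-1)^i σ_i τ_{k-i}`. -/
theorem manin_newton_identities
    {R : Type*} [Ring R] {n : ℕ} (M : Matrix (Fin n) (Fin n) R)
    (hcol : ∀ i k j, Commute (M i j) (M k j))
    (hcross : ∀ i j k l, M i j * M k l - M k l * M i j = M k j * M i l - M i l * M k j)
    (σ τ : ℕ → R)
    (hσ : ∀ k, σ k =
      (detCol (fun i j => Polynomial.C (M i j) +
        if i = j then (Polynomial.X : Polynomial R) else 0)).coeff (n - k))
    (hτ : ∀ i, τ i = Matrix.trace (M ^ i)) :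
    ∀ k, 1 ≤ k → k ≤ n →
      ((-1 : ℤ) ^ (k + 1) * (k : ℤ)) • σ k =
        ∑ i ∈ Finset.range k, ((-1 : ℤ) ^ i) • (σ i * τ (k - i)) := by
  have hdet k : σ k = (detCol (addX M)).coeff (n - k) := hσ k
  have hadj : adjCol (addX M) * addX M = Matrix.diagonal fun _ => detCol (addX M) :=
    adjCol_mul _ (commute_addX M hcol) fun i j k l => by
      rw [commutator_addX, commutator_addX, hcross]
  obtain ⟨hzero, hsucc⟩ := coeff_mul_addX M (adjCol (addX M))
  have hdiag (m : ℕ) : ((Matrix.diagonal fun _ : Fin n => detCol (addX M)).map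
      (Polynomial.coeff · m)) = Matrix.diagonal fun _ => (detCol (addX M)).coeff m :=
    Matrix.diagonal_map (by simp)
  simp only [hadj, hdiag] at hzero hsucc
  have htrace (m : ℕ) : ((adjCol (addX M)).map (Polynomial.coeff · m)).trace =
      (m + 1) • (detCol (addX M)).coeff (m + 1) := by
    have h := congrArg (Polynomial.coeff · m) (trace_adjCol_addX M)
    simp only [Polynomial.coeff_derivative] at h
    rw [nsmul_eq_mul', Nat.cast_succ, ← h]
    simp [Matrix.trace, Polynomial.finsetSum_coeff]
  have hexpand : ∀ k, k ≤ n → (adjCol (addX M)).map (Polynomial.coeff · (n - k)) * M =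
      ∑ i ∈ Finset.range k,
        ((-1 : ℤ) ^ (k + i + 1)) • ((Matrix.diagonal fun _ => σ i) * M ^ (k - i)) := by
    intro k
    induction k with
    | zero =>
      intro _
      have : (adjCol (addX M)).map (Polynomial.coeff · n) = 0 := by
        ext i j
        exact coeff_adjCol_addX M i j
      simp [this]
    | succ k ih =>
      intro hk
      have h := hsucc (n - (k + 1))
      rw [show n - (k + 1) + 1 = n - k by omega, ih (by omega), ← hdet] at h
      rw [eq_sub_of_add_eq' h.symm, sub_mul, Finset.sum_range_succ, Finset.sum_mul,
        sub_eq_add_neg, add_comm, ← Finset.sum_neg_distrib]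
      congr 1
      · refine Finset.sum_congr rfl fun i hi => ?_
        rw [Nat.succ_sub (Finset.mem_range.1 hi).le, pow_succ M, smul_mul_assoc, mul_assoc,
          ← neg_smul]
        congr 1
        ring
      · have : (-1 : ℤ) ^ (k + 1 + k + 1) = 1 := Even.neg_one_pow ⟨k + 1, by ring⟩
        simp [this]
  intro k _ hkn
  have hdiag_trace (c : R) (B : Matrix (Fin n) (Fin n) R) :
      ((Matrix.diagonal fun _ => c) * B).trace = c * B.trace := by
    simp [Matrix.trace, Finset.mul_sum]
  have hleft : ((adjCol (addX M)).map (Polynomial.coeff · (n - k)) * M).trace = k • σ k := by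
    rcases hkn.eq_or_lt with rfl | hlt
    · rw [hdet, Nat.sub_self, ← hzero]
      simp [Matrix.trace]
    · have h := congrArg Matrix.trace (hsucc (n - (k + 1)))
      rw [Matrix.trace_add, htrace, show n - (k + 1) + 1 = n - k by omega, ← hdet] at h
      rw [eq_sub_of_add_eq h.symm, sub_eq_iff_eq_add, ← add_smul,
        show k + (n - k) = n by omega]
      simp [Matrix.trace]
  rw [mul_smul, natCast_zsmul, ← hleft, hexpand k hkn, Matrix.trace_sum, Finset.smul_sum]
  refine Finset.sum_congr rfl fun i _ => ?_
  rw [Matrix.trace_smul, hdiag_trace, ← hτ, smul_smul]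
  congr 1
  rw [← pow_add, show k + 1 + (k + i + 1) = 2 * (k + 1) + i by ring, pow_add, pow_mul]
  simp
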